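/- For every natural number p ≥ 3 there exists a constant C > 0, depending only on p, such that for every bivariate polynomial q of total degree ≤ p the following holds on the unit square K = (0,1)². Let q̂ be the unique bivariate polynomial of total degree ≤ p − 4 satisfying ∫_K (q − q̂) m dx dy = 0 for every bivariate polynomial m of total degree ≤ p − 4 (with q̂ = 0 when p = 3). Then ∫_K |D²q|² dx dy ≤ C ( ∫_K q̂² dx dy + ∫_{∂K} q² dμ + ∫_{∂K} (∂_n q)² dμ ), where |D²q|² is the sum of the squares of all four second-order partial derivatives of q, the boundary integrals are taken with respect to the one-dimensional Hausdorff (arclength) measure μ on ∂K, and on each of the four edges of K the normal derivative ∂_n q is the derivative of q in the direction of the constant outward unit normal of that edge. -/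

import Mathlib

open MeasureTheory

/-- The space of bivariate real polynomials of total degree at most `k`, for an
integer `k` (so that `k < 0` gives the zero space, e.g. `P₋₁ = {0}`). -/
def polyLE (k : ℤ) : Set (MvPolynomial (Fin 2) ℝ) :=
  {m | m = 0 ∨ (0 ≤ k ∧ (m.totalDegree : ℤ) ≤ k)}

/-- Evaluation of a bivariate polynomial at a point of `ℝ × ℝ`. -/
noncomputable def evP (q : MvPolynomial (Fin 2) ℝ) (z : ℝ × ℝ) : ℝ :=
  MvPolynomial.eval ![z.1, z.2] q

/-- Sum of the squares of the four second-order partial derivatives of a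
bivariate polynomial, i.e. `|D²q|²`. -/
noncomputable def hessSqP (q : MvPolynomial (Fin 2) ℝ) (z : ℝ × ℝ) : ℝ :=
  (evP (MvPolynomial.pderiv (0 : Fin 2) (MvPolynomial.pderiv (0 : Fin 2) q)) z) ^ 2 +
  (evP (MvPolynomial.pderiv (1 : Fin 2) (MvPolynomial.pderiv (0 : Fin 2) q)) z) ^ 2 +
  (evP (MvPolynomial.pderiv (0 : Fin 2) (MvPolynomial.pderiv (1 : Fin 2) q)) z) ^ 2 +
  (evP (MvPolynomial.pderiv (1 : Fin 2) (MvPolynomial.pderiv (1 : Fin 2) q)) z) ^ 2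

/-- The outward normal derivative of a bivariate polynomial on the boundary of
the unit square: on each edge it is the derivative in the direction of the
constant outward unit normal of that edge. -/
noncomputable def normalDerivP (q : MvPolynomial (Fin 2) ℝ) (z : ℝ × ℝ) : ℝ :=
  if z.2 = 0 then -(evP (MvPolynomial.pderiv (1 : Fin 2) q) z)
  else if z.2 = 1 then evP (MvPolynomial.pderiv (1 : Fin 2) q) z
  else if z.1 = 0 then -(evP (MvPolynomial.pderiv (0 : Fin 2) q) z)
  else if z.1 = 1 then evP (MvPolynomial.pderiv (0 : Fin 2) q) z
  else 0

open MvPolynomial in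
lemma aux_eval_ext (q : MvPolynomial (Fin 2) ℝ)
    (h : ∀ z ∈ Set.Ioo (0 : ℝ) 1 ×ˢ Set.Ioo (0 : ℝ) 1, evP q z = 0) : q = 0 := by
  refine MvPolynomial.funext_set (fun _ => Set.Ioo (0 : ℝ) 1)
    (fun _ => Set.Ioo_infinite one_pos) ?_
  intro x hx
  have h1 := h (x 0, x 1) ⟨hx 0 trivial, hx 1 trivial⟩
  have h2 : ![x 0, x 1] = x := by ext i; fin_cases i <;> rfl
  simp only [evP, h2] at h1
  simpa using h1

/-- parametrization of the line `x_i = c` -/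
noncomputable def edgeP (i : Fin 2) (c t : ℝ) : ℝ × ℝ := if i = 0 then (c, t) else (t, c)

lemma edgeP_isometry (i : Fin 2) (c : ℝ) : Isometry (edgeP i c) := by
  apply Isometry.of_dist_eq
  intro a b
  unfold edgeP
  split_ifs <;> simp [Prod.dist_eq]

lemma evP_continuous (q : MvPolynomial (Fin 2) ℝ) : Continuous (evP q) := by
  unfold evP
  have : Continuous fun z : ℝ × ℝ => ![z.1, z.2] := by
    refine continuous_pi fun i => ?_
    fin_cases i
    · exact continuous_fst
    · exact continuous_snd
  exact (MvPolynomial.continuous_eval q).comp this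

lemma evP_add (q r : MvPolynomial (Fin 2) ℝ) (z : ℝ × ℝ) : evP (q + r) z = evP q z + evP r z := by
  simp [evP]
lemma evP_mul (q r : MvPolynomial (Fin 2) ℝ) (z : ℝ × ℝ) : evP (q * r) z = evP q z * evP r z := by
  simp [evP]
lemma evP_pow (q : MvPolynomial (Fin 2) ℝ) (n : ℕ) (z : ℝ × ℝ) : evP (q ^ n) z = evP q z ^ n := by
  simp [evP]
lemma evP_smul (a : ℝ) (q : MvPolynomial (Fin 2) ℝ) (z : ℝ × ℝ) : evP (a • q) z = a * evP q z := by
  simp [evP, MvPolynomial.smul_eval]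

open MvPolynomial in
lemma aux_dvd_sub (i : Fin 2) (c : ℝ) (q : MvPolynomial (Fin 2) ℝ) :
    (X i - C c : MvPolynomial (Fin 2) ℝ) ∣
      q - bind₁ (fun j => if j = i then C c else X j) q := by
  induction q using MvPolynomial.induction_on with
  | C a => simp
  | add p q hp hq =>
    rw [map_add, add_sub_add_comm]
    exact dvd_add hp hq
  | mul_X p j hp =>
    rw [map_mul, bind₁_X_right]
    have : p * X j - (bind₁ (fun j => if j = i then C c else X j) p) * (if j = i then C c else X j)
      = (p - bind₁ (fun j => if j = i then C c else X j) p) * X j +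
        bind₁ (fun j => if j = i then C c else X j) p * (X j - (if j = i then C c else X j)) := by
      ring
    rw [this]
    refine dvd_add (hp.mul_right _) (Dvd.dvd.mul_left ?_ _)
    split_ifs with h
    · rw [h]
    · simp

open MvPolynomial in
lemma aux_dvd (i : Fin 2) (c : ℝ) (q : MvPolynomial (Fin 2) ℝ)
    (h : ∀ t ∈ Set.Ioo (0 : ℝ) 1, evP q (edgeP i c t) = 0) :
    (X i - C c : MvPolynomial (Fin 2) ℝ) ∣ q := by
  have h1 := aux_dvd_sub i c q
  have h2 : bind₁ (fun j => if j = i then C c else X j) q = 0 := by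
    apply aux_eval_ext
    intro z hz
    have h3 : evP (bind₁ (fun j => if j = i then C c else X j) q) z
        = evP q (edgeP i c (if i = 0 then z.2 else z.1)) := by
      unfold evP
      rw [← MvPolynomial.aeval_eq_eval, ← MvPolynomial.aeval_eq_eval, aeval_bind₁]
      have : (fun j : Fin 2 => (aeval ![z.1, z.2]) (if j = i then C c else X j : MvPolynomial (Fin 2) ℝ))
        = ![(edgeP i c (if i = 0 then z.2 else z.1)).1, (edgeP i c (if i = 0 then z.2 else z.1)).2] := by
        ext j
        fin_cases i <;> fin_cases j <;> simp [edgeP]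
      rw [this]
    rw [h3]
    apply h
    split_ifs
    · exact hz.2
    · exact hz.1
  rwa [h2, sub_zero] at h1

/-- `q` and its normal derivative vanish on the edge. -/
def FlatP (i : Fin 2) (c : ℝ) (q : MvPolynomial (Fin 2) ℝ) : Prop :=
  ∀ t ∈ Set.Ioo (0 : ℝ) 1, evP q (edgeP i c t) = 0 ∧
    evP (MvPolynomial.pderiv i q) (edgeP i c t) = 0

lemma evP_lin_edge (i : Fin 2) (c t : ℝ) :
    evP (MvPolynomial.X i - MvPolynomial.C c) (edgeP i c t) = 0 := by
  fin_cases i <;> simp [evP, edgeP]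

open MvPolynomial in
lemma FlatP.dvd {i : Fin 2} {c : ℝ} {q : MvPolynomial (Fin 2) ℝ} (h : FlatP i c q) :
    ∃ s, q = (X i - C c) ^ 2 * s := by
  obtain ⟨s, rfl⟩ := aux_dvd i c q fun t ht => (h t ht).1
  obtain ⟨r, rfl⟩ := aux_dvd i c s fun t ht => by
    have := (h t ht).2
    rw [Derivation.leibniz, evP_add, smul_eq_mul, smul_eq_mul, evP_mul, evP_mul, evP_lin_edge] at this
    simpa [evP] using this
  exact ⟨r, by ring⟩

lemma FlatP.of_mul {i : Fin 2} {c : ℝ} {l s : MvPolynomial (Fin 2) ℝ} (h : FlatP i c (l * s))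
    (hl : ∀ t ∈ Set.Ioo (0 : ℝ) 1, evP l (edgeP i c t) ≠ 0) : FlatP i c s := by
  intro t ht
  obtain ⟨h1, h2⟩ := h t ht
  have h3 : evP s (edgeP i c t) = 0 := by
    rw [evP_mul] at h1
    exact (mul_eq_zero.1 h1).resolve_left (hl t ht)
  refine ⟨h3, ?_⟩
  rw [Derivation.leibniz, evP_add, smul_eq_mul, smul_eq_mul, evP_mul, evP_mul, h3] at h2
  simp only [zero_mul, add_zero] at h2
  exact (mul_eq_zero.1 h2).resolve_left (hl t ht)

open MvPolynomial in
lemma aux_factor (q : MvPolynomial (Fin 2) ℝ) (h0 : FlatP 0 0 q) (h1 : FlatP 0 1 q)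
    (h2 : FlatP 1 0 q) (h3 : FlatP 1 1 q) :
    ∃ r, q = ((X 0 - C 0) * (X 0 - C 1) * (X 1 - C 0) * (X 1 - C 1)) ^ 2 * r := by
  obtain ⟨s, rfl⟩ := h0.dvd
  replace h1 := h1.of_mul (by intro t ht; simp [evP, edgeP])
  replace h2 := h2.of_mul (by intro t ht; simp [evP, edgeP, ht.1.ne'])
  replace h3 := h3.of_mul (by intro t ht; simp [evP, edgeP, ht.1.ne'])
  obtain ⟨s, rfl⟩ := h1.dvd
  replace h2 := h2.of_mul (by intro t ht; simp [evP, edgeP, sub_eq_zero, ht.2.ne])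
  replace h3 := h3.of_mul (by intro t ht; simp [evP, edgeP, sub_eq_zero, ht.2.ne])
  obtain ⟨s, rfl⟩ := h2.dvd
  replace h3 := h3.of_mul (by intro t ht; simp [evP, edgeP])
  obtain ⟨s, rfl⟩ := h3.dvd
  exact ⟨s, by ring⟩

open MvPolynomial in
lemma aux_lin (i : Fin 2) (c : ℝ) : (X i - C c : MvPolynomial (Fin 2) ℝ) ≠ 0 ∧
    1 ≤ (X i - C c : MvPolynomial (Fin 2) ℝ).totalDegree := by
  have key : (X i - C c : MvPolynomial (Fin 2) ℝ).totalDegree ≠ 0 := by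
    intro h
    rw [totalDegree_eq_zero_iff_eq_C] at h
    generalize coeff 0 (X i - C c : MvPolynomial (Fin 2) ℝ) = a at h
    have := congrArg (eval fun _ => a + c + 1) h
    simp at this
    linarith
  refine ⟨?_, by omega⟩
  intro h
  simp [h] at key

lemma aux_degree (r : MvPolynomial (Fin 2) ℝ) (hr : r ≠ 0) :
    r.totalDegree + 4 ≤ (((MvPolynomial.X 0 - MvPolynomial.C 0) * (MvPolynomial.X 0 - MvPolynomial.C 1)
      * (MvPolynomial.X 1 - MvPolynomial.C 0) * (MvPolynomial.X 1 - MvPolynomial.C 1)) ^ 2 * r :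
      MvPolynomial (Fin 2) ℝ).totalDegree := by
  obtain ⟨a1, b1⟩ := aux_lin 0 0
  obtain ⟨a2, b2⟩ := aux_lin 0 1
  obtain ⟨a3, b3⟩ := aux_lin 1 0
  obtain ⟨a4, b4⟩ := aux_lin 1 1
  have e1 := mul_ne_zero a1 a2
  have e2 := mul_ne_zero e1 a3
  have e3 := mul_ne_zero e2 a4
  rw [pow_two, MvPolynomial.totalDegree_mul_of_isDomain (mul_ne_zero e3 e3) hr,
    MvPolynomial.totalDegree_mul_of_isDomain e3 e3,
    MvPolynomial.totalDegree_mul_of_isDomain e2 a4,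
    MvPolynomial.totalDegree_mul_of_isDomain e1 a3,
    MvPolynomial.totalDegree_mul_of_isDomain a1 a2]
  omega

/-! measure part -/

lemma aux_edge_ae (F : Set (ℝ × ℝ)) (hF : MeasurableSet F) (f : ℝ × ℝ → ℝ)
    (h : ∀ᵐ z ∂((μH[1] : Measure (ℝ × ℝ)).restrict F), f z = 0) (i : Fin 2) (c : ℝ)
    (hc : ∀ t ∈ Set.Ioo (0 : ℝ) 1, edgeP i c t ∈ F) (g : ℝ → ℝ) (hg : Continuous g)
    (hfg : ∀ t ∈ Set.Ioo (0 : ℝ) 1, f (edgeP i c t) = 0 → g t = 0) :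
    ∀ t ∈ Set.Ioo (0 : ℝ) 1, g t = 0 := by
  rw [ae_restrict_iff' hF, ae_iff] at h
  have h1 : (volume : Measure ℝ) (edgeP i c ⁻¹' {z | ¬ (z ∈ F → f z = 0)}) = 0 := by
    rw [← hausdorffMeasure_real, ← (edgeP_isometry i c).hausdorffMeasure_image (Or.inl zero_le_one)]
    exact measure_mono_null (Set.image_preimage_subset _ _) h
  have h2 : g =ᵐ[(volume : Measure ℝ).restrict (Set.Ioo 0 1)] fun _ => 0 := by
    rw [Filter.EventuallyEq, ae_restrict_iff' measurableSet_Ioo, ae_iff]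
    refine measure_mono_null ?_ h1
    intro t ht
    simp only [Set.mem_ofPred_eq, Classical.not_imp, Set.mem_preimage] at ht ⊢
    exact ⟨hc t ht.1, fun h0 => ht.2 (hfg t ht.1 h0)⟩
  exact Measure.eqOn_open_of_ae_eq h2 isOpen_Ioo hg.continuousOn continuousOn_const

/-- the open unit square -/
def Ksq : Set (ℝ × ℝ) := Set.Ioo (0 : ℝ) 1 ×ˢ Set.Ioo (0 : ℝ) 1

lemma frontier_Ksq : frontier Ksq =
    Set.Icc (0 : ℝ) 1 ×ˢ {0, 1} ∪ {0, 1} ×ˢ Set.Icc (0 : ℝ) 1 := by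
  rw [Ksq, frontier_prod_eq, closure_Ioo zero_ne_one, frontier_Ioo one_pos]

lemma edge_mem (i : Fin 2) (c : ℝ) (hc : c = 0 ∨ c = 1) (t : ℝ) (ht : t ∈ Set.Ioo (0 : ℝ) 1) :
    edgeP i c t ∈ frontier Ksq := by
  rw [frontier_Ksq]
  have := Set.Ioo_subset_Icc_self ht
  fin_cases i
  · right; exact ⟨hc, this⟩
  · left; exact ⟨this, hc⟩

lemma frontier_finite : (μH[1] : Measure (ℝ × ℝ)) (frontier Ksq) < ⊤ := by
  have hsub : frontier Ksq ⊆ (edgeP 0 0 '' Set.Icc 0 1 ∪ edgeP 0 1 '' Set.Icc 0 1) ∪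
      (edgeP 1 0 '' Set.Icc 0 1 ∪ edgeP 1 1 '' Set.Icc 0 1) := by
    rw [frontier_Ksq]
    rintro ⟨x, y⟩ (⟨hx, hy | hy⟩ | ⟨hx | hx, hy⟩)
    · right; left; exact ⟨x, hx, by simp [edgeP]; exact hy.symm⟩
    · right; right; exact ⟨x, hx, by simp [edgeP]; exact hy.symm⟩
    · left; left; exact ⟨y, hy, by simp [edgeP]; exact hx.symm⟩
    · left; right; exact ⟨y, hy, by simp [edgeP]; exact hx.symm⟩
  refine (measure_mono hsub).trans_lt ?_
  have h1 : ∀ i c, (μH[1] : Measure (ℝ × ℝ)) (edgeP i c '' Set.Icc 0 1) < ⊤ := by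
    intro i c
    rw [(edgeP_isometry i c).hausdorffMeasure_image (Or.inl zero_le_one), hausdorffMeasure_real]
    simp
  exact measure_union_lt_top (measure_union_lt_top (h1 _ _) (h1 _ _))
    (measure_union_lt_top (h1 _ _) (h1 _ _))

lemma aux_memLp (μ : Measure (ℝ × ℝ)) (s : Set (ℝ × ℝ)) (hs : MeasurableSet s)
    (hsub : s ⊆ closure Ksq) (hμ : μ s < ⊤) (f g : ℝ × ℝ → ℝ) (hf : Measurable f)
    (hg : Continuous g) (hfg : ∀ z, |f z| ≤ g z) : MemLp f 2 (μ.restrict s) := by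
  haveI : IsFiniteMeasure (μ.restrict s) := ⟨by simpa using hμ⟩
  have hc : IsCompact (closure Ksq) := by
    rw [Ksq, closure_prod_eq, closure_Ioo zero_ne_one]
    exact isCompact_Icc.prod isCompact_Icc
  obtain ⟨C, hC⟩ := hc.exists_bound_of_continuousOn hg.continuousOn
  refine MemLp.of_bound hf.aestronglyMeasurable C ?_
  rw [ae_restrict_iff' hs]
  refine Filter.Eventually.of_forall fun z hz => ?_
  exact (hfg z).trans ((le_abs_self _).trans (hC z (hsub hz)))

lemma aux_toLp (μ : Measure (ℝ × ℝ)) (Φ : MvPolynomial (Fin 2) ℝ →ₗ[ℝ] (ℝ × ℝ → ℝ))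
    (h : ∀ q, MemLp (Φ q) 2 μ) :
    ∃ J : MvPolynomial (Fin 2) ℝ →ₗ[ℝ] Lp ℝ 2 μ, ∀ q, J q =ᵐ[μ] Φ q := by
  refine ⟨{ toFun := fun q => (h q).toLp _, map_add' := ?_, map_smul' := ?_ }, ?_⟩
  · intro q r
    rw [← MemLp.toLp_add]
    exact MemLp.toLp_congr _ _ (by rw [map_add])
  · intro a q
    rw [RingHom.id_apply, ← MemLp.toLp_const_smul]
    exact MemLp.toLp_congr _ _ (by rw [map_smul])
  · intro q
    exact MemLp.coeFn_toLp (h q)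

lemma aux_inner {μ : Measure (ℝ × ℝ)} {u v : Lp ℝ 2 μ} {f g : ℝ × ℝ → ℝ} (hu : u =ᵐ[μ] f)
    (hv : v =ᵐ[μ] g) : inner ℝ u v = ∫ z, f z * g z ∂μ := by
  rw [L2.inner_def]
  refine integral_congr_ae ?_
  filter_upwards [hu, hv] with z h1 h2
  rw [h1, h2]
  simp [mul_comm]

lemma aux_norm {μ : Measure (ℝ × ℝ)} {u : Lp ℝ 2 μ} {f : ℝ × ℝ → ℝ} (hu : u =ᵐ[μ] f) :
    ∫ z, f z ^ 2 ∂μ = ‖u‖ ^ 2 := by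
  rw [← real_inner_self_eq_norm_sq, aux_inner hu hu]
  simp [pow_two]

lemma aux_bound {V F G : Type*} [AddCommGroup V] [Module ℝ V] [NormedAddCommGroup F]
    [NormedSpace ℝ F] [NormedAddCommGroup G] [NormedSpace ℝ G] (W : Submodule ℝ V)
    [FiniteDimensional ℝ W] (T : V →ₗ[ℝ] F) (S : V →ₗ[ℝ] G)
    (h : ∀ w ∈ W, T w = 0 → w = 0) : ∃ C : ℝ, 0 ≤ C ∧ ∀ w ∈ W, ‖S w‖ ≤ C * ‖T w‖ := by
  let T' : W →ₗ[ℝ] F := T ∘ₗ W.subtype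
  have hinj : Function.Injective T' := by
    rw [← LinearMap.ker_eq_bot, LinearMap.ker_eq_bot']
    intro w hw
    exact Subtype.ext (h w w.2 hw)
  let e := LinearEquiv.ofInjective T' hinj
  haveI : FiniteDimensional ℝ (LinearMap.range T') := inferInstance
  let g : LinearMap.range T' →L[ℝ] G :=
    LinearMap.toContinuousLinearMap (S ∘ₗ W.subtype ∘ₗ e.symm.toLinearMap)
  refine ⟨‖g‖, g.opNorm_nonneg, fun w hw => ?_⟩
  have h1 := g.le_opNorm (e ⟨w, hw⟩)
  have h2 : g (e ⟨w, hw⟩) = S w := by simp [g]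
  rw [h2] at h1
  exact h1

lemma aux_int4 {μ : Measure (ℝ × ℝ)} {f g h k : ℝ × ℝ → ℝ} (hf : Integrable f μ)
    (hg : Integrable g μ) (hh : Integrable h μ) (hk : Integrable k μ) :
    ∫ z, f z + g z + h z + k z ∂μ =
      ∫ z, f z ∂μ + ∫ z, g z ∂μ + ∫ z, h z ∂μ + ∫ z, k z ∂μ := by
  have h1 := integral_add hf hg
  have h2 := integral_add (hf.add hg) hh
  have h3 := integral_add ((hf.add hg).add hh) hk
  simp only [Pi.add_apply] at h1 h2 h3
  rw [h3, h2, h1]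

/-- evaluation as a linear map -/
noncomputable def evL : MvPolynomial (Fin 2) ℝ →ₗ[ℝ] (ℝ × ℝ → ℝ) where
  toFun := evP
  map_add' q r := by ext z; exact evP_add q r z
  map_smul' a q := by ext z; exact evP_smul a q z

/-- normal derivative as a linear map -/
noncomputable def ndL : MvPolynomial (Fin 2) ℝ →ₗ[ℝ] (ℝ × ℝ → ℝ) where
  toFun := normalDerivP
  map_add' q r := by
    ext z
    simp only [normalDerivP, Pi.add_apply, map_add, evP_add]
    split_ifs <;> ring
  map_smul' a q := by
    ext z
    simp only [normalDerivP, Pi.smul_apply, Derivation.map_smul, evP_smul, smul_eq_mul, RingHom.id_apply]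
    split_ifs <;> ring

lemma nd_meas (q : MvPolynomial (Fin 2) ℝ) : Measurable (normalDerivP q) := by
  have m1 := fun r => (evP_continuous r).measurable
  unfold normalDerivP
  refine Measurable.ite (measurableSet_eq_fun measurable_snd measurable_const) (m1 _).neg ?_
  refine Measurable.ite (measurableSet_eq_fun measurable_snd measurable_const) (m1 _) ?_
  refine Measurable.ite (measurableSet_eq_fun measurable_fst measurable_const) (m1 _).neg ?_
  exact Measurable.ite (measurableSet_eq_fun measurable_fst measurable_const) (m1 _) measurable_const

lemma nd_bound (q : MvPolynomial (Fin 2) ℝ) (z : ℝ × ℝ) : |normalDerivP q z| ≤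
    |evP (MvPolynomial.pderiv (0 : Fin 2) q) z| + |evP (MvPolynomial.pderiv (1 : Fin 2) q) z| := by
  unfold normalDerivP
  split_ifs <;> simp <;> positivity

lemma Ksq_finite : (volume : Measure (ℝ × ℝ)) Ksq < ⊤ := by
  rw [Ksq, Measure.volume_eq_prod, Measure.prod_prod]
  simp

lemma Ksq_open : IsOpen Ksq := isOpen_Ioo.prod isOpen_Ioo

lemma aux_Kext (q : MvPolynomial (Fin 2) ℝ)
    (h : ∀ᵐ z ∂((volume : Measure (ℝ × ℝ)).restrict Ksq), evP q z = 0) : q = 0 := by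
  apply aux_eval_ext
  have h2 : evP q =ᵐ[(volume : Measure (ℝ × ℝ)).restrict Ksq] fun _ => 0 := h
  exact Measure.eqOn_open_of_ae_eq h2 Ksq_open (evP_continuous q).continuousOn continuousOn_const

lemma aux_flat (q : MvPolynomial (Fin 2) ℝ)
    (h1 : ∀ᵐ z ∂((μH[1] : Measure (ℝ × ℝ)).restrict (frontier Ksq)), evP q z = 0)
    (h2 : ∀ᵐ z ∂((μH[1] : Measure (ℝ × ℝ)).restrict (frontier Ksq)), normalDerivP q z = 0)
    (i : Fin 2) (c : ℝ) (hc : c = 0 ∨ c = 1) : FlatP i c q := by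
  have hm : MeasurableSet (frontier Ksq) := isClosed_frontier.measurableSet
  have hcont : Continuous (edgeP i c) := (edgeP_isometry i c).continuous
  intro t ht
  refine ⟨aux_edge_ae _ hm _ h1 i c (edge_mem i c hc) (fun t => evP q (edgeP i c t))
    ((evP_continuous _).comp hcont) (fun _ _ h => h) t ht,
    aux_edge_ae _ hm _ h2 i c (edge_mem i c hc)
      (fun t => evP (MvPolynomial.pderiv i q) (edgeP i c t))
    ((evP_continuous _).comp hcont) ?_ t ht⟩
  intro t ht h
  have e1 := ht.1.ne'
  have e2 := ht.2.ne
  rcases hc with rfl | rfl <;> fin_cases i <;> simpa [normalDerivP, edgeP, e1, e2] using h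

/-- lower stability bound for the `C¹` (biharmonic) virtual
element stabilization on the unit square, for polynomials of total degree ≤ p:
`|q|²_{2,K} ≤ C (‖Π⁰_{p−4} q‖²_{0,K} + ‖q‖²_{0,∂K} + ‖∂ₙq‖²_{0,∂K})`.
The boundary integrals are with respect to the 1-dimensional Hausdorff measure. -/
theorem stmt_10 (p : ℕ) (hp : 3 ≤ p) :
    ∃ C : ℝ, 0 < C ∧ ∀ q qhat : MvPolynomial (Fin 2) ℝ,
      q.totalDegree ≤ p →
      qhat ∈ polyLE ((p : ℤ) - 4) →
      (∀ m ∈ polyLE ((p : ℤ) - 4),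
        (∫ z in Set.Ioo (0 : ℝ) 1 ×ˢ Set.Ioo (0 : ℝ) 1,
          (evP q z - evP qhat z) * evP m z) = 0) →
      (∫ z in Set.Ioo (0 : ℝ) 1 ×ˢ Set.Ioo (0 : ℝ) 1, hessSqP q z) ≤
        C * ((∫ z in Set.Ioo (0 : ℝ) 1 ×ˢ Set.Ioo (0 : ℝ) 1, (evP qhat z) ^ 2) +
          (∫ z in frontier (Set.Ioo (0 : ℝ) 1 ×ˢ Set.Ioo (0 : ℝ) 1),
            (evP q z) ^ 2 ∂(μH[1])) +
          ∫ z in frontier (Set.Ioo (0 : ℝ) 1 ×ˢ Set.Ioo (0 : ℝ) 1),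
            (normalDerivP q z) ^ 2 ∂(μH[1])) := by
  change ∃ C : ℝ, 0 < C ∧ ∀ q qhat : MvPolynomial (Fin 2) ℝ,
      q.totalDegree ≤ p →
      qhat ∈ polyLE ((p : ℤ) - 4) →
      (∀ m ∈ polyLE ((p : ℤ) - 4),
        (∫ z in Ksq, (evP q z - evP qhat z) * evP m z) = 0) →
      (∫ z in Ksq, hessSqP q z) ≤
        C * ((∫ z in Ksq, (evP qhat z) ^ 2) +
          (∫ z in frontier Ksq, (evP q z) ^ 2 ∂(μH[1])) +
          ∫ z in frontier Ksq, (normalDerivP q z) ^ 2 ∂(μH[1]))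
  have hmF : MeasurableSet (frontier Ksq) := isClosed_frontier.measurableSet
  have memK : ∀ q, MemLp (evL q) 2 ((volume : Measure (ℝ × ℝ)).restrict Ksq) := fun q =>
    aux_memLp _ _ Ksq_open.measurableSet subset_closure Ksq_finite _ (fun z => |evP q z|)
      (evP_continuous q).measurable (evP_continuous q).abs (fun z => le_rfl)
  have memF : ∀ q, MemLp (evL q) 2 ((μH[1] : Measure (ℝ × ℝ)).restrict (frontier Ksq)) := fun q =>
    aux_memLp _ _ hmF frontier_subset_closure frontier_finite _ (fun z => |evP q z|)
      (evP_continuous q).measurable (evP_continuous q).abs (fun z => le_rfl)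
  have memN : ∀ q, MemLp (ndL q) 2 ((μH[1] : Measure (ℝ × ℝ)).restrict (frontier Ksq)) := fun q =>
    aux_memLp _ _ hmF frontier_subset_closure frontier_finite _ _
      (nd_meas q) ((evP_continuous _).abs.add (evP_continuous _).abs) (nd_bound q)
  obtain ⟨JK, hJK⟩ := aux_toLp _ _ memK
  obtain ⟨JF, hJF⟩ := aux_toLp _ _ memF
  obtain ⟨JN, hJN⟩ := aux_toLp _ _ memN
  let R := MvPolynomial.restrictTotalDegree (Fin 2) ℝ p
  let O : Submodule ℝ (MvPolynomial (Fin 2) ℝ × MvPolynomial (Fin 2) ℝ) :=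
    { carrier := {w | ∀ m ∈ polyLE ((p : ℤ) - 4), inner ℝ (JK (w.1 - w.2)) (JK m) = 0}
      add_mem' := by
        intro a b ha hb m hm
        have : (a + b).1 - (a + b).2 = (a.1 - a.2) + (b.1 - b.2) := by
          simp only [Prod.fst_add, Prod.snd_add]; ring
        rw [this, map_add, inner_add_left, ha m hm, hb m hm, add_zero]
      zero_mem' := by
        intro m hm
        simp
      smul_mem' := by
        intro c a ha m hm
        have : (c • a).1 - (c • a).2 = c • (a.1 - a.2) := by
          simp only [Prod.smul_fst, Prod.smul_snd, smul_sub]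
        rw [this, map_smul, real_inner_smul_left, ha m hm, mul_zero] }
  let W : Submodule ℝ (MvPolynomial (Fin 2) ℝ × MvPolynomial (Fin 2) ℝ) := R.prod R ⊓ O
  haveI : FiniteDimensional ℝ R :=
    inferInstanceAs (Module.Finite ℝ (MvPolynomial.restrictTotalDegree (Fin 2) ℝ p))
  haveI : FiniteDimensional ℝ (R.prod R) :=
    Module.Finite.iff_fg.2 ((Module.Finite.iff_fg.1 ‹_›).prod (Module.Finite.iff_fg.1 ‹_›))
  haveI : FiniteDimensional ℝ W := Submodule.finiteDimensional_of_le inf_le_left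
  let T := (JK ∘ₗ LinearMap.snd ℝ _ _).prod
    ((JF ∘ₗ LinearMap.fst ℝ (MvPolynomial (Fin 2) ℝ) (MvPolynomial (Fin 2) ℝ)).prod
      (JN ∘ₗ LinearMap.fst ℝ _ _))
  have hinner : ∀ a m, inner ℝ (JK a) (JK m) = ∫ z in Ksq, evP a z * evP m z := fun a m =>
    aux_inner (hJK a) (hJK m)
  have hT : ∀ w ∈ W, T w = 0 → w = 0 := by
    rintro ⟨q, qhat⟩ hw hT
    have hq : q.totalDegree ≤ p := (MvPolynomial.mem_restrictTotalDegree _ _ _).1 hw.1.1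
    have hO : ∀ m ∈ polyLE ((p : ℤ) - 4), inner ℝ (JK (q - qhat)) (JK m) = 0 := hw.2
    have t1 : JK qhat = 0 := congrArg (fun x => x.1) hT
    have t2 : JF q = 0 := congrArg (fun x => x.2.1) hT
    have t3 : JN q = 0 := congrArg (fun x => x.2.2) hT
    have hqh : qhat = 0 := by
      apply aux_Kext
      have := hJK qhat
      rw [t1] at this
      filter_upwards [this, Lp.coeFn_zero ℝ 2 ((volume : Measure (ℝ × ℝ)).restrict Ksq)] with z h1 h2
      rw [h2] at h1
      exact h1.symm
    have f1 : ∀ᵐ z ∂((μH[1] : Measure (ℝ × ℝ)).restrict (frontier Ksq)), evP q z = 0 := by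
      have := hJF q
      rw [t2] at this
      filter_upwards [this, Lp.coeFn_zero ℝ 2 ((μH[1] : Measure (ℝ × ℝ)).restrict (frontier Ksq))]
        with z h1 h2
      rw [h2] at h1
      exact h1.symm
    have f2 : ∀ᵐ z ∂((μH[1] : Measure (ℝ × ℝ)).restrict (frontier Ksq)),
        normalDerivP q z = 0 := by
      have := hJN q
      rw [t3] at this
      filter_upwards [this, Lp.coeFn_zero ℝ 2 ((μH[1] : Measure (ℝ × ℝ)).restrict (frontier Ksq))]
        with z h1 h2
      rw [h2] at h1
      exact h1.symm
    have flat := aux_flat q f1 f2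
    obtain ⟨r, hr⟩ := aux_factor q (flat 0 0 (Or.inl rfl)) (flat 0 1 (Or.inr rfl))
      (flat 1 0 (Or.inl rfl)) (flat 1 1 (Or.inr rfl))
    have hq0 : q = 0 := by
      by_cases hr0 : r = 0
      · rw [hr, hr0, mul_zero]
      exfalso
      have hdeg := aux_degree r hr0
      rw [← hr] at hdeg
      have hmem : r ∈ polyLE ((p : ℤ) - 4) := Or.inr ⟨by omega, by omega⟩
      have h0 := hO r hmem
      rw [hqh, sub_zero] at h0
      set b : MvPolynomial (Fin 2) ℝ := (MvPolynomial.X 0 - MvPolynomial.C 0) *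
        (MvPolynomial.X 0 - MvPolynomial.C 1) * (MvPolynomial.X 1 - MvPolynomial.C 0) *
        (MvPolynomial.X 1 - MvPolynomial.C 1) with hb
      have h1 : ‖JK (b * r)‖ ^ 2 = 0 := by
        rw [← aux_norm (hJK (b * r)), ← h0, hinner]
        refine integral_congr_ae (Filter.Eventually.of_forall fun z => ?_)
        change evP (b * r) z ^ 2 = evP q z * evP r z
        rw [hr, evP_mul b r, evP_mul (b ^ 2) r, evP_pow b]
        ring
      have h2 : JK (b * r) = 0 := by simpa using h1
      have h3 : b * r = 0 := by
        apply aux_Kext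
        have := hJK (b * r)
        rw [h2] at this
        filter_upwards [this, Lp.coeFn_zero ℝ 2 ((volume : Measure (ℝ × ℝ)).restrict Ksq)]
          with z h1 h2
        rw [h2] at h1
        exact h1.symm
      have hb0 : b ≠ 0 := mul_ne_zero (mul_ne_zero (mul_ne_zero (aux_lin 0 0).1 (aux_lin 0 1).1)
        (aux_lin 1 0).1) (aux_lin 1 1).1
      exact (mul_ne_zero hb0 hr0) h3
    rw [hq0, hqh]
    rfl
  have hS : ∀ i j : Fin 2, ∃ C : ℝ, 0 ≤ C ∧ ∀ w ∈ W,
      ‖JK (MvPolynomial.pderiv i (MvPolynomial.pderiv j w.1))‖ ≤ C * ‖T w‖ := fun i j =>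
    aux_bound W T (JK ∘ₗ (MvPolynomial.pderiv i).toLinearMap ∘ₗ
      (MvPolynomial.pderiv j).toLinearMap ∘ₗ LinearMap.fst ℝ _ _) hT
  choose c hc0 hc using hS
  refine ⟨c 0 0 ^ 2 + c 1 0 ^ 2 + c 0 1 ^ 2 + c 1 1 ^ 2 + 1, by positivity, ?_⟩
  intro q qhat hq hqhat horth
  have hqhat' : qhat.totalDegree ≤ p := by
    rcases hqhat with rfl | ⟨_, h⟩
    · simp
    · omega
  have hw : (q, qhat) ∈ W := by
    refine ⟨⟨(MvPolynomial.mem_restrictTotalDegree _ _ _).2 hq,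
      (MvPolynomial.mem_restrictTotalDegree _ _ _).2 hqhat'⟩, ?_⟩
    intro m hm
    rw [hinner, ← horth m hm]
    refine integral_congr_ae (Filter.Eventually.of_forall fun z => ?_)
    simp [evP]
  have hTn : ‖T (q, qhat)‖ ^ 2 ≤ ‖JK qhat‖ ^ 2 + ‖JF q‖ ^ 2 + ‖JN q‖ ^ 2 := by
    have : ‖T (q, qhat)‖ = max ‖JK qhat‖ (max ‖JF q‖ ‖JN q‖) := rfl
    rw [this]
    have a1 := sq_nonneg ‖JK qhat‖
    have a2 := sq_nonneg ‖JF q‖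
    have a3 := sq_nonneg ‖JN q‖
    rcases max_cases ‖JF q‖ ‖JN q‖ with ⟨h, _⟩ | ⟨h, _⟩ <;> rw [h]
    · rcases max_cases ‖JK qhat‖ ‖JF q‖ with ⟨h, _⟩ | ⟨h, _⟩ <;> rw [h] <;> linarith
    · rcases max_cases ‖JK qhat‖ ‖JN q‖ with ⟨h, _⟩ | ⟨h, _⟩ <;> rw [h] <;> linarith
  have n1 : ∫ z in Ksq, (evP qhat z) ^ 2 = ‖JK qhat‖ ^ 2 := aux_norm (hJK qhat)
  have n2 : ∫ z in frontier Ksq, (evP q z) ^ 2 ∂(μH[1]) = ‖JF q‖ ^ 2 := aux_norm (hJF q)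
  have n3 : ∫ z in frontier Ksq, (normalDerivP q z) ^ 2 ∂(μH[1]) = ‖JN q‖ ^ 2 :=
    aux_norm (hJN q)
  have nK : ∀ a, ∫ z in Ksq, (evP a z) ^ 2 = ‖JK a‖ ^ 2 := fun a => aux_norm (hJK a)
  have iK : ∀ a, Integrable (fun z => (evP a z) ^ 2) ((volume : Measure (ℝ × ℝ)).restrict Ksq) :=
    fun a => (memK a).integrable_sq
  have bd : ∀ i j, ‖JK (MvPolynomial.pderiv i (MvPolynomial.pderiv j q))‖ ^ 2 ≤
      c i j ^ 2 * ‖T (q, qhat)‖ ^ 2 := by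
    intro i j
    rw [← mul_pow]
    exact pow_le_pow_left₀ (norm_nonneg _) (hc i j (q, qhat) hw) 2
  have hess : ∫ z in Ksq, hessSqP q z =
      ‖JK (MvPolynomial.pderiv 0 (MvPolynomial.pderiv 0 q))‖ ^ 2 +
      ‖JK (MvPolynomial.pderiv 1 (MvPolynomial.pderiv 0 q))‖ ^ 2 +
      ‖JK (MvPolynomial.pderiv 0 (MvPolynomial.pderiv 1 q))‖ ^ 2 +
      ‖JK (MvPolynomial.pderiv 1 (MvPolynomial.pderiv 1 q))‖ ^ 2 := by
    unfold hessSqP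
    rw [aux_int4 (iK _) (iK _) (iK _) (iK _), nK, nK, nK, nK]
  rw [hess, n1, n2, n3]
  have := bd 0 0
  have := bd 1 0
  have := bd 0 1
  have := bd 1 1
  calc _ ≤ (c 0 0 ^ 2 + c 1 0 ^ 2 + c 0 1 ^ 2 + c 1 1 ^ 2 + 1) * ‖T (q, qhat)‖ ^ 2 := by
        nlinarith [sq_nonneg ‖T (q, qhat)‖]
    _ ≤ _ := by gcongr
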